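/- arXiv:math/0505036 — 2 statements merged into one kernel-verified Lean document; each statement's English description precedes it below -/
import Mathlib

section
/- Let φ: S₁ → S₂ be a holomorphic bijection between simply connected open subsets of ℂ with φ(s₁) = s₂. Let r₁ be the inner radius of S₁ at s₁ (the supremum of ρ with B(s₁, ρ) ⊆ S₁) and r₂ the inner radius of S₂ at s₂. Then r₂ ≥ (1/4)·r₁·|φ'(s₁)|. -/
section
open Real Set Filter Topology MeasureTheory

lemma kq_circle {k : ℂ → ℂ} (hk : DifferentiableOn ℂ k (Metric.ball 0 1)) {s : ℝ} (hs0 : 0 < s)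
    (hs1 : s < 1) :
    2 * π * ((s ^ 4)⁻¹ + ‖k 0‖ ^ 2) ≤
      ∫ θ in (-π)..π, ‖-((circleMap 0 s θ) ^ 2)⁻¹ + k (circleMap 0 s θ)‖ ^ 2 := by
  set b := k 0 with hb
  let H : ℂ → ℂ := fun z => -(z ^ 2 / (s:ℂ) ^ 4) * k z + (starRingEnd ℂ) b * (k z - b)
  have hsub : Metric.closedBall (0:ℂ) s ⊆ Metric.ball 0 1 := Metric.closedBall_subset_ball hs1
  have hkc : DifferentiableOn ℂ k (Metric.closedBall 0 s) := hk.mono hsub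
  have hHd : DifferentiableOn ℂ H (Metric.closedBall 0 s) := by
    unfold H
    fun_prop
  have hcl : closure (Metric.ball (0:ℂ) s) = Metric.closedBall 0 s := closure_ball _ hs0.ne'
  have hav : circleAverage H 0 s = H 0 := by
    apply DiffContOnCl.circleAverage
    rw [abs_of_pos hs0]
    exact DifferentiableOn.diffContOnCl (by rwa [hcl])
  have hH0 : H 0 = 0 := by simp [H, ← hb]
  rw [hH0, circleAverage_def, smul_eq_zero] at hav
  have hcm : ∀ θ, circleMap 0 s θ ∈ Metric.closedBall (0:ℂ) s := fun θ =>
    circleMap_mem_closedBall _ hs0.le _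
  have hint : ∫ θ in (-π)..π, H (circleMap 0 s θ) = 0 := by
    have hper : Function.Periodic (fun θ => H (circleMap 0 s θ)) (2 * π) := fun θ => by
      simp [periodic_circleMap 0 s θ]
    have := hper.intervalIntegral_add_eq (-π) 0
    rw [show -π + 2 * π = π by ring, zero_add] at this
    rw [this]
    exact hav.resolve_left (by positivity)
  have hcont : Continuous (fun θ => H (circleMap 0 s θ)) :=
    hHd.continuousOn.comp_continuous (continuous_circleMap 0 s) hcm
  have hkcont : Continuous (fun θ => k (circleMap 0 s θ)) :=
    hkc.continuousOn.comp_continuous (continuous_circleMap 0 s) hcm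
  have hne : ∀ θ, circleMap 0 s θ ≠ 0 := fun θ => circleMap_ne_center hs0.ne'
  have hrecont : Continuous (fun θ => (H (circleMap 0 s θ)).re) :=
    Complex.continuous_re.comp hcont
  have hmc : Continuous (fun θ => 2 * (H (circleMap 0 s θ)).re) :=
    continuous_const.mul hrecont
  have hre : ∫ θ in (-π)..π, (H (circleMap 0 s θ)).re = 0 := by
    have := Complex.reCLM.intervalIntegral_comp_comm
      (hcont.intervalIntegrable (μ := volume) (-π) π)
    simp only [Complex.reCLM_apply] at this
    rw [this, hint]; simp
  calc 2 * π * ((s ^ 4)⁻¹ + ‖b‖ ^ 2)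
      = ∫ θ in (-π)..π, (((s ^ 4)⁻¹ + ‖b‖ ^ 2) + 2 * (H (circleMap 0 s θ)).re) := by
        rw [intervalIntegral.integral_add (by simp)
          (hmc.intervalIntegrable _ _),
          intervalIntegral.integral_const_mul, hre]
        simp; ring
    _ ≤ _ := by
        apply intervalIntegral.integral_mono_on (by linarith [pi_pos])
        · exact (continuous_const.add (continuous_const.mul hrecont)).intervalIntegrable _ _
        · apply Continuous.intervalIntegrable
          have : Continuous (fun θ => ((circleMap 0 s θ) ^ 2)⁻¹) :=
            ((continuous_circleMap 0 s).pow 2).inv₀ (fun θ => pow_ne_zero _ (hne θ))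
          exact (this.neg.add hkcont).norm.pow 2
        · intro θ _
          have hz := hne θ
          have hzn : ‖circleMap 0 s θ‖ = s := by simp [abs_of_pos hs0]
          generalize circleMap 0 s θ = z at *
          have h1 : (z ^ 2)⁻¹ = (starRingEnd ℂ) (z ^ 2) / (s:ℂ) ^ 4 := by
            have : z ^ 2 * (starRingEnd ℂ) (z ^ 2) = (s:ℂ) ^ 4 := by
              rw [Complex.mul_conj, Complex.normSq_eq_norm_sq, norm_pow, hzn]; push_cast; ring
            have h4 : (s:ℂ) ^ 4 ≠ 0 := by exact_mod_cast (by positivity : s ^ 4 ≠ 0)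
            rw [eq_div_iff h4, ← this, inv_mul_cancel_left₀ (pow_ne_zero _ hz)]
          have h2 : ‖(z^2)⁻¹‖ ^ 2 = (s ^ 4)⁻¹ := by
            rw [norm_inv, norm_pow, hzn]; field_simp
          have h3 : (H z).re = (-((starRingEnd ℂ) ((z ^ 2)⁻¹) * k z)).re
              + ((starRingEnd ℂ) b * (k z - b)).re := by
            have : (starRingEnd ℂ) ((z ^ 2)⁻¹) = z ^ 2 / (s:ℂ) ^ 4 := by rw [h1]; simp
            rw [this]; simp [H]
          rw [h3, ← h2]
          generalize (z ^ 2)⁻¹ = a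
          generalize k z = c
          simp only [← Complex.normSq_eq_norm_sq, Complex.normSq_apply, Complex.add_re,
            Complex.add_im, Complex.neg_re, Complex.neg_im, Complex.mul_re, Complex.conj_re,
            Complex.conj_im, Complex.sub_re, Complex.sub_im]
          nlinarith [sq_nonneg (c.re - b.re), sq_nonneg (c.im - b.im)]

lemma kq_area {k : ℂ → ℂ} (hk : DifferentiableOn ℂ k (Metric.ball 0 1)) {r ρ : ℝ} (hr : 0 < r)
    (hrρ : r < ρ) (hρ : ρ < 1) :
    ENNReal.ofReal (π * ((r ^ 2)⁻¹ - (ρ ^ 2)⁻¹) + π * ‖k 0‖ ^ 2 * (ρ ^ 2 - r ^ 2)) ≤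
      ∫⁻ z in {z : ℂ | r < ‖z‖ ∧ ‖z‖ < ρ}, ENNReal.ofReal (‖-(z ^ 2)⁻¹ + k z‖ ^ 2) := by
  set A : Set ℂ := {z : ℂ | r < ‖z‖ ∧ ‖z‖ < ρ} with hA
  have hAo : IsOpen A := (isOpen_lt continuous_const continuous_norm).inter
    (isOpen_lt continuous_norm continuous_const)
  set F : ℂ → ENNReal := fun z => ENNReal.ofReal (‖-(z ^ 2)⁻¹ + k z‖ ^ 2) with hF
  have hAb : A ⊆ Metric.ball 0 1 := fun z hz => by
    simp only [Metric.mem_ball, dist_zero_right]; exact hz.2.trans hρ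
  have hFc : ContinuousOn F A := by
    apply ENNReal.continuous_ofReal.comp_continuousOn
    apply (ContinuousOn.norm _).pow 2
    apply ContinuousOn.add _ (hk.continuousOn.mono hAb)
    apply (ContinuousOn.inv₀ (by fun_prop) _).neg
    intro z hz
    have : z ≠ 0 := norm_pos_iff.mp (hr.trans hz.1)
    positivity
  have hFm : Measurable (A.indicator F) := by
    classical
    rw [← Set.piecewise_eq_indicator]
    exact hFc.measurable_piecewise (continuousOn_const) hAo.measurableSet
  rw [← lintegral_indicator hAo.measurableSet, ← Complex.lintegral_comp_polarCoord_symm,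
    polarCoord_target]
  have hpm : Measurable (fun p : ℝ × ℝ => Complex.polarCoord.symm p) := by
    simp only [Complex.polarCoord_symm_apply]
    fun_prop
  rw [Measure.volume_eq_prod, ← Measure.prod_restrict, lintegral_prod _ (by
    apply Measurable.aemeasurable
    exact (by fun_prop : Measurable fun p : ℝ × ℝ => ENNReal.ofReal p.1).smul (hFm.comp hpm))]
  have hsub : Ioo r ρ ⊆ Ioi (0:ℝ) := fun s hs => hr.trans hs.1
  refine le_trans ?_ (lintegral_mono_set hsub)
  have key : ∀ s ∈ Ioo r ρ, ENNReal.ofReal (2 * π * ((s ^ 3)⁻¹ + ‖k 0‖ ^ 2 * s)) ≤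
      ∫⁻ θ in Ioo (-π) π, ENNReal.ofReal s • A.indicator F (Complex.polarCoord.symm (s, θ)) := by
    intro s hs
    have hs0 : 0 < s := hr.trans hs.1
    have hcm : ∀ θ, Complex.polarCoord.symm (s, θ) = circleMap 0 s θ := fun θ => by
      rw [Complex.polarCoord_symm_apply, circleMap_zero, Complex.exp_mul_I]; simp
    have hne : ∀ θ, circleMap 0 s θ ≠ 0 := fun θ => circleMap_ne_center hs0.ne'
    have hmem : ∀ θ, circleMap 0 s θ ∈ A := fun θ => by
      simp [hA, abs_of_pos hs0, hs.1, hs.2]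
    have hkcont : Continuous (fun θ => k (circleMap 0 s θ)) :=
      (hk.continuousOn.mono hAb).comp_continuous (continuous_circleMap 0 s) hmem
    have hcont : Continuous (fun θ => ‖-((circleMap 0 s θ) ^ 2)⁻¹ + k (circleMap 0 s θ)‖ ^ 2) := by
      have : Continuous (fun θ => ((circleMap 0 s θ) ^ 2)⁻¹) :=
        ((continuous_circleMap 0 s).pow 2).inv₀ (fun θ => pow_ne_zero _ (hne θ))
      exact (this.neg.add hkcont).norm.pow 2
    simp only [hcm, Set.indicator_of_mem (hmem _), smul_eq_mul]
    rw [lintegral_const_mul' _ _ ENNReal.ofReal_ne_top]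
    simp only [hF]
    rw [← ofReal_integral_eq_lintegral_ofReal
      ((hcont.integrableOn_Icc (a := -π) (b := π)).mono_set Ioo_subset_Icc_self)
      (ae_of_all _ fun θ => by positivity), ← ENNReal.ofReal_mul hs0.le]
    apply ENNReal.ofReal_le_ofReal
    rw [← integral_Ioc_eq_integral_Ioo, ← intervalIntegral.integral_of_le (by linarith [pi_pos])]
    have := mul_le_mul_of_nonneg_left (kq_circle hk hs0 (hs.2.trans hρ)) hs0.le
    refine le_trans (le_of_eq ?_) this
    field_simp
  refine le_trans ?_ (setLIntegral_mono' measurableSet_Ioo key)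
  have hcI : ContinuousOn (fun s : ℝ => 2 * π * ((s ^ 3)⁻¹ + ‖k 0‖ ^ 2 * s)) (Icc r ρ) := by
    apply ContinuousOn.mul continuousOn_const
    apply ContinuousOn.add _ (by fun_prop)
    apply ContinuousOn.inv₀ (by fun_prop)
    intro s hs
    have : 0 < s := hr.trans_le hs.1
    positivity
  rw [← ofReal_integral_eq_lintegral_ofReal
    (hcI.integrableOn_Icc.mono_set Ioo_subset_Icc_self)
    ((ae_restrict_iff' measurableSet_Ioo).2 (ae_of_all _ fun s hs => by
      have : 0 < s := hsub hs
      simp only [Pi.zero_apply]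
      positivity)),
    ← integral_Ioc_eq_integral_Ioo, ← intervalIntegral.integral_of_le hrρ.le]
  apply ENNReal.ofReal_le_ofReal
  apply le_of_eq
  rw [intervalIntegral.integral_eq_sub_of_hasDerivAt
    (f := fun s => π * (-(s ^ 2)⁻¹ + ‖k 0‖ ^ 2 * s ^ 2))]
  · ring
  · intro s hs
    rw [uIcc_of_le hrρ.le] at hs
    have hs0 : 0 < s := hr.trans_le hs.1
    have h1 : HasDerivAt (fun s : ℝ => s ^ 2) (2 * s) s := by simpa using hasDerivAt_pow 2 s
    have h2 : HasDerivAt (fun s => π * (-(s ^ 2)⁻¹ + ‖k 0‖ ^ 2 * s ^ 2))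
        (π * (-(-(2 * s) / (s ^ 2) ^ 2) + ‖k 0‖ ^ 2 * (2 * s))) s :=
      ((h1.inv (by positivity)).neg.add (h1.const_mul (‖k 0‖ ^ 2))).const_mul π
    exact h2.congr_deriv (by field_simp)
  · apply ContinuousOn.intervalIntegrable
    rwa [uIcc_of_le hrρ.le]

noncomputable def kqM (c : ℂ) : ℂ →L[ℝ] ℂ :=
  ContinuousLinearMap.id ℝ ℂ - (ContinuousLinearMap.mul ℝ ℂ c).comp Complex.conjCLE.toContinuousLinearMap

lemma kqM_apply (c w : ℂ) : kqM c w = w - c * (starRingEnd ℂ) w := by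
  simp [kqM]

lemma kqM_det (c : ℂ) : (kqM c).det = 1 - ‖c‖ ^ 2 := by
  rw [ContinuousLinearMap.det, ← LinearMap.det_toMatrix Complex.basisOneI, Matrix.det_fin_two]
  simp only [LinearMap.toMatrix_apply, ContinuousLinearMap.coe_coe, kqM_apply]
  simp [← Complex.normSq_eq_norm_sq, Complex.normSq_apply]
  ring

lemma kq_mulDet (a : ℂ) : 
    ((ContinuousLinearMap.restrictScalars ℝ (ContinuousLinearMap.toSpanSingleton ℂ a)) : ℂ →L[ℝ] ℂ).det = ‖a‖ ^ 2 := by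
  rw [ContinuousLinearMap.det, ← LinearMap.det_toMatrix Complex.basisOneI, Matrix.det_fin_two]
  simp only [LinearMap.toMatrix_apply]
  simp [← Complex.normSq_eq_norm_sq, Complex.normSq_apply]

/-- volume of the image of the annulus -/
lemma kq_volume {N : ℂ → ℂ} (hN : DifferentiableOn ℂ N (Metric.ball 0 1))
    (hinj : InjOn (fun z => z⁻¹ + N z) (Metric.ball 0 1 \ {0})) {r ρ : ℝ} (hr : 0 < r)
    (hrρ : r < ρ) (hρ : ρ < 1) :
    ENNReal.ofReal (π * ((r ^ 2)⁻¹ - (ρ ^ 2)⁻¹) + π * ‖deriv N 0‖ ^ 2 * (ρ ^ 2 - r ^ 2)) ≤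
      volume ((fun z => z⁻¹ + N z) '' {z : ℂ | r < ‖z‖ ∧ ‖z‖ < ρ}) := by
  set A : Set ℂ := {z : ℂ | r < ‖z‖ ∧ ‖z‖ < ρ} with hA
  have hAo : IsOpen A := (isOpen_lt continuous_const continuous_norm).inter
    (isOpen_lt continuous_norm continuous_const)
  have hAb : A ⊆ Metric.ball 0 1 \ {0} := fun z hz => by
    constructor
    · simp only [Metric.mem_ball, dist_zero_right]; exact hz.2.trans hρ
    · exact norm_pos_iff.mp (hr.trans hz.1)
  have hd : ∀ z ∈ A, HasFDerivWithinAt (fun z => z⁻¹ + N z)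
      ((ContinuousLinearMap.restrictScalars ℝ
        (ContinuousLinearMap.toSpanSingleton ℂ (-(z ^ 2)⁻¹ + deriv N z))) : ℂ →L[ℝ] ℂ) A z := by
    intro z hz
    have h1 : HasDerivAt N (deriv N z) z :=
      (hN.differentiableAt (Metric.isOpen_ball.mem_nhds (hAb hz).1)).hasDerivAt
    have h2 : HasDerivAt (fun z => z⁻¹ + N z) (-(z ^ 2)⁻¹ + deriv N z) z :=
      (hasDerivAt_inv (hAb hz).2).add h1
    exact (h2.hasFDerivAt.restrictScalars ℝ).hasFDerivWithinAt
  have h := lintegral_image_eq_lintegral_abs_det_fderiv_mul volume hAo.measurableSet hd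
    (hinj.mono hAb) (fun _ => 1)
  simp only [kq_mulDet, mul_one, lintegral_const, one_mul, Measure.restrict_apply_univ] at h
  rw [h]
  refine (kq_area (hN.deriv Metric.isOpen_ball) hr hrρ hρ).trans (le_of_eq ?_)
  simp only [abs_pow, abs_norm, hA]

/-- topological part: the image of the outer annulus lies in an almost-ellipse -/
lemma kq_cover {N : ℂ → ℂ} (hN : DifferentiableOn ℂ N (Metric.ball 0 1))
    (hinj : InjOn (fun z => z⁻¹ + N z) (Metric.ball 0 1 \ {0})) {b : ℂ} {C δ : ℝ} (hC : 0 ≤ C)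
    (hδ1 : δ < 1)
    (hN1 : ∀ z ∈ Metric.ball (0:ℂ) δ, ‖N z‖ ≤ 1)
    (hNb : ∀ z ∈ Metric.ball (0:ℂ) δ, ‖N z - b * z‖ ≤ C * ‖z‖ ^ 2)
    {r : ℝ} (hr : 0 < r) (hrδ : r < δ) {z : ℂ} (hz : r < ‖z‖) (hz1 : ‖z‖ < 1) :
    ‖kqM (b * r ^ 2) (z⁻¹ + N z)‖ ≤ 1 / r + (C + ‖b‖ ^ 2 + ‖b‖ * C) * r ^ 2 := by
  set R := 1 / r + (C + ‖b‖ ^ 2 + ‖b‖ * C) * r ^ 2 with hR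
  set M := kqM (b * r ^ 2) with hM
  let G : ℂ → ℂ := fun z => z / (1 + z * N z)
  have hden : ∀ z ∈ Metric.ball (0:ℂ) δ, 1 + z * N z ≠ 0 := by
    intro z hz h
    have h1 : ‖z * N z‖ < 1 := by
      rw [norm_mul]
      have : ‖z‖ < 1 := by simpa using (mem_ball_zero_iff.1 hz).trans hδ1
      nlinarith [hN1 z hz, norm_nonneg z, norm_nonneg (N z)]
    have h2 : z * N z = -1 := by linear_combination h
    rw [h2] at h1
    simp at h1
  have hδ : Metric.ball (0:ℂ) δ ⊆ Metric.ball 0 1 := Metric.ball_subset_ball hδ1.le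
  have hGd : DifferentiableOn ℂ G (Metric.ball 0 δ) := by
    have := hN.mono hδ
    exact DifferentiableOn.div (by fun_prop) (by fun_prop) hden
  have hGg : ∀ z ∈ Metric.ball (0:ℂ) δ, z ≠ 0 → (G z)⁻¹ = z⁻¹ + N z := by
    intro z hz hz0
    have := hden z hz
    simp only [G]
    field_simp
  have hG0 : ∀ z ∈ Metric.ball (0:ℂ) δ, G z = 0 → z = 0 := by
    intro z hz h
    simpa [G, hden z hz] using h
  have hsubr : Metric.ball (0:ℂ) r ⊆ Metric.ball 0 δ := Metric.ball_subset_ball hrδ.le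
  have hsubrc : Metric.closedBall (0:ℂ) r ⊆ Metric.ball 0 δ := Metric.closedBall_subset_ball hrδ
  have hopen : IsOpen (G '' Metric.ball 0 r) := by
    rcases (hGd.analyticOnNhd Metric.isOpen_ball).is_constant_or_isOpen
      (convex_ball (0:ℂ) δ).isPreconnected with ⟨w, hw⟩ | h
    · exfalso
      have h0 : (0:ℂ) ∈ Metric.ball (0:ℂ) δ := by simpa using hr.trans hrδ
      have hrr : (r:ℂ) ∈ Metric.ball (0:ℂ) δ := by simpa [abs_of_pos hr] using hrδ
      have h1 : G r = 0 := by rw [hw _ hrr, ← hw 0 h0]; simp [G]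
      have := hG0 _ hrr h1
      exact hr.ne' (by exact_mod_cast this)
    · exact h _ hsubr Metric.isOpen_ball
  let E : Set ℂ := {w | w = 0 ∨ R < ‖M w⁻¹‖}
  have hE0 : (0:ℂ) ∈ E := Or.inl rfl
  have hEs : StarConvex ℝ 0 E := by
    rw [starConvex_zero_iff]
    intro w hw a ha0 ha1
    rcases hw with rfl | hw
    · left; simp
    rcases ha0.eq_or_lt with rfl | ha
    · left; simp
    right
    have : (a • w)⁻¹ = a⁻¹ • w⁻¹ := by
      simp [mul_comm]
    rw [this, map_smul, norm_smul, norm_inv, Real.norm_of_nonneg ha0]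
    have : 1 ≤ a⁻¹ := (one_le_inv₀ ha).2 ha1
    nlinarith [norm_nonneg (M w⁻¹)]
  have hsph : ∀ z : ℂ, ‖z‖ = r → G z ∉ E := by
    intro z hz hzE
    have hz0 : z ≠ 0 := norm_pos_iff.1 (hz ▸ hr)
    have hzb : z ∈ Metric.ball (0:ℂ) δ := by simpa [hz] using hrδ
    rcases hzE with h | h
    · exact hz0 (hG0 z hzb h)
    rw [hGg z hzb hz0, hM, kqM_apply] at h
    obtain ⟨e, he⟩ : ∃ e, e = N z - b * z := ⟨_, rfl⟩
    have hNe : N z = b * z + e := by rw [he]; ring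
    have hen : ‖e‖ ≤ C * r ^ 2 := by rw [he, ← hz]; exact hNb z hzb
    have hconj : (r:ℂ) ^ 2 * (starRingEnd ℂ) z⁻¹ = z := by
      have h1 : z * (starRingEnd ℂ) z = (r:ℂ) ^ 2 := by
        rw [Complex.mul_conj, Complex.normSq_eq_norm_sq, hz]; push_cast; ring
      have h2 : (starRingEnd ℂ) z ≠ 0 := by simpa using hz0
      rw [map_inv₀, ← h1, mul_inv_cancel_right₀ h2]
    have heq : z⁻¹ + N z - b * r ^ 2 * (starRingEnd ℂ) (z⁻¹ + N z)
        = z⁻¹ + (e - b * r ^ 2 * (starRingEnd ℂ) (b * z + e)) := by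
      rw [map_add, hNe]
      linear_combination (-b) * hconj
    rw [heq] at h
    have hb1 : ‖b * z + e‖ ≤ ‖b‖ * r + C * r ^ 2 := by
      refine (norm_add_le _ _).trans ?_
      rw [norm_mul, hz]; gcongr
    have hfin : ‖z⁻¹ + (e - b * r ^ 2 * (starRingEnd ℂ) (b * z + e))‖ ≤
        1 / r + (C * r ^ 2 + ‖b‖ * r ^ 2 * (‖b‖ * r + C * r ^ 2)) := by
      refine (norm_add_le _ _).trans ?_
      rw [norm_inv, hz, one_div]
      gcongr
      refine (norm_sub_le _ _).trans ?_
      rw [norm_mul, norm_mul, RCLike.norm_conj, norm_pow, Complex.norm_of_nonneg hr.le]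
      gcongr
    have hr1 : r < 1 := hrδ.trans hδ1
    have : ‖b‖ * r ^ 2 * (‖b‖ * r + C * r ^ 2) ≤ ‖b‖ * r ^ 2 * (‖b‖ + C) := by
      have h1 : ‖b‖ * r ≤ ‖b‖ := mul_le_of_le_one_right (norm_nonneg _) hr1.le
      have h2 : C * r ^ 2 ≤ C := mul_le_of_le_one_right hC (pow_le_one₀ hr.le hr1.le)
      gcongr
    rw [hR] at h
    nlinarith
  have hEsub : E ⊆ G '' Metric.ball 0 r := by
    refine (hEs.isPathConnected hE0).isConnected.isPreconnected.subset_of_closure_inter_subset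
      hopen ⟨0, hE0, 0, by simpa using hr, by simp [G]⟩ ?_
    rintro w ⟨hw, hwE⟩
    have hcl : closure (G '' Metric.ball 0 r) ⊆ G '' Metric.closedBall 0 r := by
      apply closure_minimal (image_mono Metric.ball_subset_closedBall)
      exact ((isCompact_closedBall (0:ℂ) r).image_of_continuousOn
        (hGd.continuousOn.mono hsubrc)).isClosed
    obtain ⟨z, hz, rfl⟩ := hcl hw
    refine ⟨z, ?_, rfl⟩
    rw [mem_closedBall_zero_iff] at hz
    rw [mem_ball_zero_iff]
    exact lt_of_le_of_ne hz (fun h => hsph z h hwE)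
  by_contra hcon
  rw [not_le] at hcon
  have hz0 : z ≠ 0 := norm_pos_iff.1 (hr.trans hz)
  obtain ⟨w, hw⟩ : ∃ w, w = z⁻¹ + N z := ⟨_, rfl⟩
  rw [← hw] at hcon
  have hw0 : w ≠ 0 := by
    rintro h
    rw [h, map_zero, norm_zero] at hcon
    have : 0 ≤ R := by positivity
    linarith
  have hwE : w⁻¹ ∈ E := Or.inr (by rwa [inv_inv])
  obtain ⟨z', hz', hGz'⟩ := hEsub hwE
  have hz'0 : z' ≠ 0 := by
    rintro rfl
    apply inv_ne_zero hw0
    rw [← hGz']; simp [G]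
  have h1 := hGg z' (hsubr hz') hz'0
  rw [hGz', inv_inv, hw] at h1
  have := hinj ⟨by simpa using hz1, hz0⟩ ⟨hδ (hsubr hz'), hz'0⟩ h1
  rw [this] at hz
  rw [mem_ball_zero_iff] at hz'
  linarith

/-- factoring out a zero at the origin -/
lemma kq_factor {f : ℂ → ℂ} (hf : DifferentiableOn ℂ f (Metric.ball 0 1)) :
    ∃ g : ℂ → ℂ, DifferentiableOn ℂ g (Metric.ball 0 1) ∧ g 0 = deriv f 0 ∧
      ∀ z, f z = f 0 + z * g z := by
  have h0 : Metric.ball (0:ℂ) 1 ∈ 𝓝 (0:ℂ) := Metric.ball_mem_nhds _ one_pos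
  refine ⟨dslope f 0, (Complex.differentiableOn_dslope h0).2 hf, dslope_same _ _, fun z => ?_⟩
  have := sub_smul_dslope f 0 z
  simp only [sub_zero, smul_eq_mul] at this
  rw [this]; ring

/-- The area theorem (first coefficient). -/
lemma kq_area_theorem {N : ℂ → ℂ} (hN : DifferentiableOn ℂ N (Metric.ball 0 1)) (hN0 : N 0 = 0)
    (hinj : InjOn (fun z => z⁻¹ + N z) (Metric.ball 0 1 \ {0})) : ‖deriv N 0‖ ≤ 1 := by
  obtain ⟨N1, hN1d, hN10, hN1⟩ := kq_factor hN
  obtain ⟨N2, hN2d, -, hN2⟩ := kq_factor hN1d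
  set b := deriv N 0 with hb
  have h0 : Metric.ball (0:ℂ) 1 ∈ 𝓝 (0:ℂ) := Metric.ball_mem_nhds _ one_pos
  have hc : ∀ᶠ z in 𝓝 (0:ℂ), ‖N z‖ < 1 :=
    ((hN.differentiableAt h0).continuousAt.norm).eventually_lt continuousAt_const (by simp [hN0])
  have hc2 : ∀ᶠ z in 𝓝 (0:ℂ), ‖N2 z‖ < ‖N2 0‖ + 1 :=
    ((hN2d.differentiableAt h0).continuousAt.norm).eventually_lt continuousAt_const (by simp)
  obtain ⟨δ', hδ'0, hδ'⟩ := Metric.eventually_nhds_iff_ball.1 (hc.and hc2)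
  obtain ⟨δ, hδ0, hδle, hδ1⟩ : ∃ δ : ℝ, 0 < δ ∧ δ ≤ δ' ∧ δ < 1 :=
    ⟨min δ' (1/2), by positivity, min_le_left _ _, (min_le_right _ _).trans_lt (by norm_num)⟩
  have hδs : Metric.ball (0:ℂ) δ ⊆ Metric.ball 0 δ' := Metric.ball_subset_ball hδle
  obtain ⟨C, hCdef⟩ : ∃ C, C = ‖N2 0‖ + 1 := ⟨_, rfl⟩
  have hC : 0 ≤ C := by rw [hCdef]; positivity
  have hB1 : ∀ z ∈ Metric.ball (0:ℂ) δ, ‖N z‖ ≤ 1 := fun z hz => (hδ' z (hδs hz)).1.le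
  have hB2 : ∀ z ∈ Metric.ball (0:ℂ) δ, ‖N z - b * z‖ ≤ C * ‖z‖ ^ 2 := fun z hz => by
    have : N z - b * z = N2 z * z ^ 2 := by
      rw [hN1 z, hN2 z, hN0, hN10]; ring
    rw [this, norm_mul, norm_pow, hCdef]
    gcongr
    exact (hδ' z (hδs hz)).2.le
  set K := C + ‖b‖ ^ 2 + ‖b‖ * C with hK
  have hKnn : 0 ≤ K := by positivity
  have key : ∀ ρ : ℝ, 0 < ρ → ρ < 1 → ∀ r : ℝ, 0 < r → r < δ → r < ρ →
      (1 - ‖b‖ ^ 2 * r ^ 4) * (‖b‖ ^ 2 * ρ ^ 2 - (ρ ^ 2)⁻¹ - ‖b‖ ^ 2 * r ^ 2) ≤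
        2 * K * r + K ^ 2 * r ^ 4 + ‖b‖ ^ 2 * r ^ 2 := by
    intro ρ hρ0 hρ1 r hr hrδ hrρ
    have hv := kq_volume hN hinj hr hrρ hρ1
    set A := (fun z => z⁻¹ + N z) '' {z : ℂ | r < ‖z‖ ∧ ‖z‖ < ρ} with hA
    have hsub : kqM (b * r ^ 2) '' A ⊆ Metric.closedBall 0 (1 / r + K * r ^ 2) := by
      rintro _ ⟨_, ⟨z, hz, rfl⟩, rfl⟩
      rw [mem_closedBall_zero_iff]
      exact kq_cover hN hinj hC hδ1 hB1 hB2 hr hrδ hz.1 (hz.2.trans hρ1)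
    have hvol := measure_mono (μ := volume) hsub
    rw [Measure.addHaar_image_continuousLinearMap, Complex.volume_closedBall,
      show LinearMap.det ((kqM (b * r ^ 2) : ℂ →L[ℝ] ℂ) : ℂ →ₗ[ℝ] ℂ) = _ from kqM_det _] at hvol
    have h1 := (mul_le_mul_right hv (ENNReal.ofReal |1 - ‖b * r ^ 2‖ ^ 2|)).trans hvol
    have hR : 0 ≤ 1 / r + K * r ^ 2 := by positivity
    rw [← ENNReal.ofReal_mul (abs_nonneg _), ← ENNReal.ofReal_pow hR,
      show ((NNReal.pi : NNReal) : ENNReal) = ENNReal.ofReal π by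
        rw [← NNReal.coe_real_pi, ENNReal.ofReal_coe_nnreal], ← ENNReal.ofReal_mul (by positivity),
      ENNReal.ofReal_le_ofReal_iff (by positivity)] at h1
    have hbn : ‖b * (r:ℂ) ^ 2‖ ^ 2 = ‖b‖ ^ 2 * r ^ 4 := by
      rw [norm_mul, norm_pow, Complex.norm_of_nonneg hr.le]; ring
    rw [hbn, ← hb] at h1
    obtain ⟨X, hX⟩ : ∃ X, X = (r ^ 2)⁻¹ - (ρ ^ 2)⁻¹ + ‖b‖ ^ 2 * (ρ ^ 2 - r ^ 2) := ⟨_, rfl⟩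
    have hX0 : 0 ≤ X := by
      have e1 : (ρ ^ 2)⁻¹ ≤ (r ^ 2)⁻¹ := by gcongr
      have e2 : r ^ 2 ≤ ρ ^ 2 := by gcongr
      rw [hX]
      have := mul_nonneg (sq_nonneg ‖b‖) (sub_nonneg.2 e2)
      linarith
    have h2 : |1 - ‖b‖ ^ 2 * r ^ 4| * X ≤ (1 / r + K * r ^ 2) ^ 2 := by
      have : π * (|1 - ‖b‖ ^ 2 * r ^ 4| * X) ≤ π * (1 / r + K * r ^ 2) ^ 2 := by
        rw [hX]; linarith
      exact le_of_mul_le_mul_left this pi_pos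
    have h3 : (1 - ‖b‖ ^ 2 * r ^ 4) * X ≤ (1 / r + K * r ^ 2) ^ 2 :=
      (mul_le_mul_of_nonneg_right (le_abs_self _) hX0).trans h2
    have e3 : (1 / r + K * r ^ 2) ^ 2 = (r ^ 2)⁻¹ + 2 * K * r + K ^ 2 * r ^ 4 := by
      field_simp
      ring
    have e4 : (1 - ‖b‖ ^ 2 * r ^ 4) * X = (r ^ 2)⁻¹ - ‖b‖ ^ 2 * r ^ 2 +
        (1 - ‖b‖ ^ 2 * r ^ 4) * (‖b‖ ^ 2 * ρ ^ 2 - (ρ ^ 2)⁻¹ - ‖b‖ ^ 2 * r ^ 2) := by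
      rw [hX]; field_simp; ring
    rw [e3, e4] at h3
    linarith
  have key2 : ∀ ρ : ℝ, 0 < ρ → ρ < 1 → ‖b‖ ^ 2 * ρ ^ 2 - (ρ ^ 2)⁻¹ ≤ 0 := by
    intro ρ hρ0 hρ1
    have t1 : Tendsto (fun r : ℝ => (1 - ‖b‖ ^ 2 * r ^ 4) *
        (‖b‖ ^ 2 * ρ ^ 2 - (ρ ^ 2)⁻¹ - ‖b‖ ^ 2 * r ^ 2)) (𝓝[>] 0)
        (𝓝 (‖b‖ ^ 2 * ρ ^ 2 - (ρ ^ 2)⁻¹)) := by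
      have := (Continuous.tendsto (by fun_prop : Continuous (fun r : ℝ => (1 - ‖b‖ ^ 2 * r ^ 4) *
        (‖b‖ ^ 2 * ρ ^ 2 - (ρ ^ 2)⁻¹ - ‖b‖ ^ 2 * r ^ 2))) 0).mono_left
          (nhdsWithin_le_nhds (s := Ioi 0))
      simpa using this
    have t2 : Tendsto (fun r : ℝ => 2 * K * r + K ^ 2 * r ^ 4 + ‖b‖ ^ 2 * r ^ 2) (𝓝[>] 0)
        (𝓝 0) := by
      have := (Continuous.tendsto (by fun_prop : Continuous (fun r : ℝ =>
        2 * K * r + K ^ 2 * r ^ 4 + ‖b‖ ^ 2 * r ^ 2)) 0).mono_left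
          (nhdsWithin_le_nhds (s := Ioi 0))
      simpa using this
    refine le_of_tendsto_of_tendsto t1 t2 ?_
    filter_upwards [Ioo_mem_nhdsGT (lt_min hδ0 hρ0)] with r hr
    exact key ρ hρ0 hρ1 r hr.1 (hr.2.trans_le (min_le_left _ _)) (hr.2.trans_le (min_le_right _ _))
  have key3 : ‖b‖ ^ 2 * 1 ^ 2 - ((1:ℝ) ^ 2)⁻¹ ≤ 0 := by
    have t : Tendsto (fun ρ : ℝ => ‖b‖ ^ 2 * ρ ^ 2 - (ρ ^ 2)⁻¹) (𝓝[<] 1)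
        (𝓝 (‖b‖ ^ 2 * 1 ^ 2 - ((1:ℝ) ^ 2)⁻¹)) := by
      have : ContinuousAt (fun ρ : ℝ => ‖b‖ ^ 2 * ρ ^ 2 - (ρ ^ 2)⁻¹) 1 := by
        fun_prop (disch := norm_num)
      exact this.tendsto.mono_left nhdsWithin_le_nhds
    refine le_of_tendsto t ?_
    filter_upwards [Ioo_mem_nhdsLT (zero_lt_one)] with ρ hρ
    exact key2 ρ hρ.1 hρ.2
  norm_num at key3
  exact key3

/-- Bieberbach's bound on the second coefficient. -/
lemma kq_bieberbach {p : ℂ → ℂ} (hp : DifferentiableOn ℂ p (Metric.ball 0 1)) (hp0 : p 0 = 1)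
    (hinj : InjOn (fun z => z * p z) (Metric.ball 0 1)) : ‖deriv p 0‖ ≤ 2 := by
  have hb0 : (0:ℂ) ∈ Metric.ball (0:ℂ) 1 := by simp
  have h0 : Metric.ball (0:ℂ) 1 ∈ 𝓝 (0:ℂ) := Metric.ball_mem_nhds _ one_pos
  have hpne : ∀ z ∈ Metric.ball (0:ℂ) 1, p z ≠ 0 := by
    intro z hz h
    have : z = 0 := hinj hz hb0 (by simp [h])
    rw [this, hp0] at h
    exact one_ne_zero h
  -- holomorphic inverse square root of p
  obtain ⟨s, hs, hs0, hsp⟩ : ∃ s : ℂ → ℂ, DifferentiableOn ℂ s (Metric.ball 0 1) ∧ s 0 = 1 ∧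
      ∀ z ∈ Metric.ball (0:ℂ) 1, s z ^ 2 * p z = 1 := by
    have hd : DifferentiableOn ℂ (fun z => deriv p z / p z) (Metric.ball 0 1) :=
      (hp.deriv Metric.isOpen_ball).div hp hpne
    obtain ⟨L, hL0, hL⟩ := hd.isExactOn_ball.with_val_at 0 0
    refine ⟨fun z => Complex.exp (-(L z) / 2), ?_, ?_, ?_⟩
    · intro z hz
      have := (hL z hz).differentiableAt
      apply DifferentiableAt.differentiableWithinAt
      fun_prop
    · simp [hL0]
    · intro z hz
      have hder : ∀ z ∈ Metric.ball (0:ℂ) 1,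
          HasDerivAt (fun z => Complex.exp (-(L z)) * p z) 0 z := by
        intro z hz
        have h1 := ((hL z hz).neg.cexp).mul
          (hp.differentiableAt (Metric.isOpen_ball.mem_nhds hz)).hasDerivAt
        refine h1.congr_deriv ?_
        have := hpne z hz
        simp only [Pi.neg_apply]
        field_simp
        ring
      have hconst := Metric.isOpen_ball.is_const_of_deriv_eq_zero
        (convex_ball (0:ℂ) 1).isPreconnected
        (fun z hz => (hder z hz).differentiableAt.differentiableWithinAt)
        (fun z hz => (hder z hz).deriv) hz hb0
      simp only [hL0, hp0] at hconst
      rw [← Complex.exp_nat_mul]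
      convert hconst using 2
      · congr 1; push_cast; ring
      · simp
  obtain ⟨n, hn, hn0, hns⟩ := kq_factor hs
  have hsne : ∀ z ∈ Metric.ball (0:ℂ) 1, s z ≠ 0 := by
    intro z hz h
    have := hsp z hz
    simp [h] at this
  have hsq : ∀ z ∈ Metric.ball (0:ℂ) 1, z ^ 2 ∈ Metric.ball (0:ℂ) 1 := by
    intro z hz
    rw [mem_ball_zero_iff] at hz ⊢
    rw [norm_pow]
    exact pow_lt_one₀ (norm_nonneg _) hz two_ne_zero
  have hnsq : DifferentiableOn ℂ (fun z => n (z ^ 2)) (Metric.ball 0 1) :=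
    hn.comp (by fun_prop) hsq
  have hNd : DifferentiableOn ℂ (fun z => z * n (z ^ 2)) (Metric.ball 0 1) :=
    differentiableOn_id.mul hnsq
  have hg : ∀ z : ℂ, z ≠ 0 → z⁻¹ + z * n (z ^ 2) = z⁻¹ * s (z ^ 2) := by
    intro z hz
    rw [hns (z ^ 2), hs0]
    field_simp
  have hA := kq_area_theorem hNd (by simp) (by
    rintro z ⟨hz, hz0⟩ w ⟨hw, hw0⟩ h
    have hz0 : z ≠ 0 := hz0
    have hw0 : w ≠ 0 := hw0
    simp only [hg z hz0, hg w hw0] at h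
    have hz2 := hsp _ (hsq z hz)
    have hw2 := hsp _ (hsq w hw)
    have hzs := hsne _ (hsq z hz)
    have hpz : z ^ 2 * p (z ^ 2) = w ^ 2 * p (w ^ 2) := by
      have e1 : z ^ 2 * p (z ^ 2) = ((z⁻¹ * s (z ^ 2)) ^ 2)⁻¹ := by
        apply eq_inv_of_mul_eq_one_left
        field_simp
        linear_combination hz2
      have e2 : w ^ 2 * p (w ^ 2) = ((w⁻¹ * s (w ^ 2)) ^ 2)⁻¹ := by
        have := hsne _ (hsq w hw)
        apply eq_inv_of_mul_eq_one_left
        field_simp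
        linear_combination hw2
      rw [e1, e2, h]
    have hzw : z ^ 2 = w ^ 2 := hinj (hsq z hz) (hsq w hw) hpz
    rw [← hzw] at h
    exact inv_injective (mul_right_cancel₀ hzs h))
  have hdN : deriv (fun z => z * n (z ^ 2)) 0 = n 0 := by
    have h1 : HasDerivAt (fun z => n (z ^ 2)) (deriv (fun z => n (z ^ 2)) 0) (0:ℂ) :=
      (hnsq.differentiableAt h0).hasDerivAt
    have h2 : HasDerivAt (fun z => z * n (z ^ 2))
        (1 * n (0 ^ 2) + 0 * deriv (fun z => n (z ^ 2)) 0) 0 := (hasDerivAt_id (0:ℂ)).mul h1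
    rw [h2.deriv]; simp
  rw [hdN, hn0] at hA
  have hps : deriv p 0 = -2 * deriv s 0 := by
    have h1 := (hs.differentiableAt h0).hasDerivAt
    have h2 := (hp.differentiableAt h0).hasDerivAt
    have h3 := (h1.pow 2).mul h2
    have h4 : HasDerivAt (s ^ 2 * p) 0 (0:ℂ) := by
      refine (hasDerivAt_const (0:ℂ) (1:ℂ)).congr_of_eventuallyEq ?_
      filter_upwards [h0] with z hz
      exact hsp z hz
    have h5 := h3.unique h4
    simp [hs0, hp0] at h5
    linear_combination h5
  rw [hps, norm_mul]
  norm_num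
  linarith

/-- Normalised Koebe quarter theorem: an omitted value has modulus at least `1/4`. -/
lemma kq_unit {p : ℂ → ℂ} (hp : DifferentiableOn ℂ p (Metric.ball 0 1)) (hp0 : p 0 = 1)
    (hinj : InjOn (fun z => z * p z) (Metric.ball 0 1)) {w : ℂ}
    (hw : ∀ z ∈ Metric.ball (0:ℂ) 1, z * p z ≠ w) : 1 / 4 ≤ ‖w‖ := by
  have h0 : Metric.ball (0:ℂ) 1 ∈ 𝓝 (0:ℂ) := Metric.ball_mem_nhds _ one_pos
  have hw0 : w ≠ 0 := fun h => hw 0 (by simp) (by simp [h])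
  have hden : ∀ z ∈ Metric.ball (0:ℂ) 1, 1 - z * p z / w ≠ 0 := by
    intro z hz h
    apply hw z hz
    field_simp at h
    linear_combination -h
  have hP : DifferentiableOn ℂ (fun z => p z / (1 - z * p z / w)) (Metric.ball 0 1) :=
    hp.div (by fun_prop) hden
  have h1 := kq_bieberbach hp hp0 hinj
  have h2 := kq_bieberbach hP (by simp [hp0]) (by
    intro x hx y hy h
    apply hinj hx hy
    have hx' := hden x hx
    have hy' := hden y hy
    simp only [← mul_div_assoc] at h
    rw [div_eq_div_iff hx' hy'] at h
    simp only
    linear_combination h)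
  have hd : deriv (fun z => p z / (1 - z * p z / w)) 0 = deriv p 0 + w⁻¹ := by
    have e1 := (hp.differentiableAt h0).hasDerivAt
    have e2 : HasDerivAt (fun z => 1 - z * p z / w) (-((1 * p 0 + 0 * deriv p 0) / w)) 0 :=
      (((hasDerivAt_id (0:ℂ)).mul e1).div_const w).const_sub 1
    have e3 : HasDerivAt (fun z => p z / (1 - z * p z / w)) _ 0 := e1.div e2 (hden 0 (by simp))
    rw [e3.deriv]
    simp [hp0]
  rw [hd] at h2
  have h3 : ‖w⁻¹‖ ≤ 4 := by
    have : w⁻¹ = (deriv p 0 + w⁻¹) - deriv p 0 := by ring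
    rw [this]
    refine (norm_sub_le _ _).trans ?_
    linarith
  rw [norm_inv] at h3
  rw [one_div]
  exact inv_le_of_inv_le₀ (norm_pos_iff.2 hw0) h3

/-- Koebe quarter theorem on a disk. -/
lemma kq_koebe {f : ℂ → ℂ} {c : ℂ} {R : ℝ} (hR : 0 < R)
    (hf : DifferentiableOn ℂ f (Metric.ball c R)) (hinj : InjOn f (Metric.ball c R)) :
    Metric.ball (f c) (1 / 4 * R * ‖deriv f c‖) ⊆ f '' Metric.ball c R := by
  intro y hy
  by_cases ha : deriv f c = 0
  · simp [ha] at hy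
  by_contra hcon
  set a := deriv f c with hadef
  have hRc : (R:ℂ) ≠ 0 := by exact_mod_cast hR.ne'
  have hmaps : ∀ z ∈ Metric.ball (0:ℂ) 1, c + R * z ∈ Metric.ball c R := by
    intro z hz
    rw [mem_ball_zero_iff] at hz
    rw [mem_ball_iff_norm]
    simp only [add_sub_cancel_left, norm_mul, Complex.norm_of_nonneg hR.le]
    nlinarith
  have hfd : DifferentiableOn ℂ (fun z => f (c + R * z)) (Metric.ball 0 1) :=
    hf.comp (by fun_prop) hmaps
  have hF : DifferentiableOn ℂ (fun z => (f (c + R * z) - f c) / (R * a)) (Metric.ball 0 1) :=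
    (hfd.sub_const _).div_const _
  obtain ⟨p, hp, hp0, hpF⟩ := kq_factor hF
  have hd : deriv (fun z => (f (c + R * z) - f c) / (R * a)) 0 = 1 := by
    have e0 : HasDerivAt f a (c + R * 0) := by
      rw [mul_zero, add_zero]
      exact (hf.differentiableAt (Metric.ball_mem_nhds _ hR)).hasDerivAt
    have e1 : HasDerivAt (fun z : ℂ => c + R * z) (R * 1) 0 :=
      ((hasDerivAt_id (0:ℂ)).const_mul (R:ℂ)).const_add c
    have e2 : HasDerivAt (fun z => (f (c + R * z) - f c) / (R * a)) (a * (R * 1) / (R * a)) 0 :=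
      ((e0.comp (0:ℂ) e1).sub_const (f c)).div_const _
    rw [e2.deriv]
    field_simp
  rw [hd] at hp0
  have hpF' : ∀ z, z * p z = (f (c + R * z) - f c) / (R * a) := by
    intro z
    rw [hpF z]; simp
  have hRa : (R:ℂ) * a ≠ 0 := mul_ne_zero hRc ha
  have h := kq_unit (w := (y - f c) / (R * a)) hp hp0 (by
      intro x hx z hz h
      simp only [hpF'] at h
      rw [div_left_inj' hRa] at h
      have := hinj (hmaps x hx) (hmaps z hz) (by linear_combination h)
      have h2 : (R:ℂ) * x = R * z := by linear_combination this
      exact mul_left_cancel₀ hRc h2) (by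
      intro z hz h
      rw [hpF', div_left_inj' hRa] at h
      exact hcon ⟨_, hmaps z hz, by linear_combination h⟩)
  rw [norm_div, norm_mul, Complex.norm_of_nonneg hR.le, le_div_iff₀ (by positivity)] at h
  rw [mem_ball_iff_norm] at hy
  linarith

/-- A holomorphic bijection onto the plane has an entire inverse. -/
lemma kq_inverse {S : Set ℂ} (hS : IsOpen S) (hSc : IsPreconnected S) {φ : ℂ → ℂ}
    (hφ : DifferentiableOn ℂ φ S) (hbij : BijOn φ S univ) :
    ∃ ψ : ℂ → ℂ, Differentiable ℂ ψ ∧ (∀ w, ψ w ∈ S) ∧ (∀ w, φ (ψ w) = w) := by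
  have hex : ∀ w, ∃ z ∈ S, φ z = w := fun w => hbij.surjOn (mem_univ w)
  choose ψ hψS hψ using hex
  refine ⟨ψ, ?_, hψS, hψ⟩
  have hopen : ∀ U ⊆ S, IsOpen U → IsOpen (φ '' U) := by
    rcases (hφ.analyticOnNhd hS).is_constant_or_isOpen hSc with ⟨w, hw⟩ | h
    · exfalso
      have h1 := (hψ 0).symm.trans (hw _ (hψS 0))
      have h2 := (hψ 1).symm.trans (hw _ (hψS 1))
      exact zero_ne_one (h1.trans h2.symm)
    · exact h
  have hcont : Continuous ψ := by
    refine continuous_def.2 fun U hU => ?_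
    have : ψ ⁻¹' U = φ '' (U ∩ S) := by
      ext w
      constructor
      · intro hw
        exact ⟨ψ w, ⟨hw, hψS w⟩, hψ w⟩
      · rintro ⟨z, ⟨hzU, hzS⟩, rfl⟩
        have : ψ (φ z) = z := hbij.injOn (hψS _) hzS (hψ _)
        simpa [this] using hzU
    rw [this]
    exact hopen _ inter_subset_right (hU.inter hS)
  have hinjψ : Function.Injective ψ := fun x y h => by rw [← hψ x, ← hψ y, h]
  intro w
  have han : AnalyticAt ℂ (deriv φ) (ψ w) := (hφ.analyticOnNhd hS _ (hψS w)).deriv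
  rcases han.eventually_eq_zero_or_eventually_ne_zero with h | h
  · exfalso
    obtain ⟨ε, hε, hεb⟩ := Metric.eventually_nhds_iff_ball.1 (h.and (hS.mem_nhds (hψS w)))
    have hmem : ψ w + (ε / 2 : ℝ) ∈ Metric.ball (ψ w) ε := by
      rw [mem_ball_iff_norm, add_sub_cancel_left, Complex.norm_of_nonneg (by positivity)]
      linarith
    have := Metric.isOpen_ball.is_const_of_deriv_eq_zero
      (convex_ball (ψ w) ε).isPreconnected (f := φ) (hφ.mono fun z hz => (hεb z hz).2)
      (fun z hz => (hεb z hz).1) hmem (Metric.mem_ball_self hε)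
    have h2 := hbij.injOn (hεb _ hmem).2 (hψS w) this
    have h3 : ((ε / 2 : ℝ) : ℂ) = 0 := by linear_combination h2
    have h4 : ε / 2 = 0 := by exact_mod_cast h3
    linarith
  · have ht : Tendsto ψ (𝓝[≠] w) (𝓝[≠] (ψ w)) :=
      hcont.continuousAt.continuousWithinAt.tendsto_nhdsWithin
        (fun x hx => fun h => hx (hinjψ h))
    have hev : ∀ᶠ x in 𝓝[≠] w, DifferentiableAt ℂ ψ x := by
      filter_upwards [ht.eventually h] with x hx
      have := HasDerivAt.of_local_left_inverse (f := φ) hcont.continuousAt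
        (hφ.differentiableAt (hS.mem_nhds (hψS x))).hasDerivAt hx (Eventually.of_forall hψ)
      exact this.differentiableAt
    exact (Complex.analyticAt_of_differentiable_on_punctured_nhds_of_continuousAt hev
      hcont.continuousAt).differentiableAt

lemma kq_not_bdd {S : Set ℂ} {s : ℂ} (h : ¬ BddAbove {ρ : ℝ | 0 < ρ ∧ Metric.ball s ρ ⊆ S}) :
    S = univ := by
  refine eq_univ_of_forall fun z => ?_
  rw [not_bddAbove_iff] at h
  obtain ⟨ρ, ⟨_, hρ⟩, hlt⟩ := h (dist z s)
  exact hρ hlt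

end

/-- Koebe ¼ theorem: if `φ : S₁ → S₂` is a holomorphic bijection
between simply connected open subsets of `ℂ` with `φ(s₁) = s₂`, and `r₁`, `r₂`
are the inner radii of `S₁` at `s₁` and of `S₂` at `s₂`, then
`r₂ ≥ (1/4)·r₁·|φ'(s₁)|`. -/
theorem stmt16 (S₁ S₂ : Set ℂ) (hS₁ : IsOpen S₁) (hS₂ : IsOpen S₂)
    (hsc₁ : SimplyConnectedSpace S₁) (hsc₂ : SimplyConnectedSpace S₂)
    (φ : ℂ → ℂ) (hφ : DifferentiableOn ℂ φ S₁) (hbij : Set.BijOn φ S₁ S₂)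
    (s₁ s₂ : ℂ) (hs₁ : s₁ ∈ S₁) (hs₂ : φ s₁ = s₂)
    (r₁ r₂ : ℝ)
    (hr₁ : r₁ = sSup {ρ : ℝ | 0 < ρ ∧ Metric.ball s₁ ρ ⊆ S₁})
    (hr₂ : r₂ = sSup {ρ : ℝ | 0 < ρ ∧ Metric.ball s₂ ρ ⊆ S₂}) :
    r₂ ≥ (1 / 4) * r₁ * ‖deriv φ s₁‖ := by
  have hr₂0 : 0 ≤ r₂ := hr₂ ▸ Real.sSup_nonneg fun x hx => hx.1.le
  by_cases hd : deriv φ s₁ = 0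
  · simpa [hd] using hr₂0
  by_cases hb₁ : BddAbove {ρ : ℝ | 0 < ρ ∧ Metric.ball s₁ ρ ⊆ S₁}
  swap
  · rw [hr₁, Real.sSup_of_not_bddAbove hb₁]
    simpa using hr₂0
  obtain ⟨ε, hε, hεS⟩ := Metric.isOpen_iff.1 hS₁ s₁ hs₁
  have hr₁0 : 0 < r₁ := by
    rw [hr₁]
    exact hε.trans_le (le_csSup hb₁ ⟨hε, hεS⟩)
  have hball : Metric.ball s₁ r₁ ⊆ S₁ := by
    intro z hz
    rw [Metric.mem_ball, hr₁] at hz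
    obtain ⟨ρ, hρ, hlt⟩ := exists_lt_of_lt_csSup
      (⟨ε, hε, hεS⟩ : {ρ : ℝ | 0 < ρ ∧ Metric.ball s₁ ρ ⊆ S₁}.Nonempty) hz
    exact hρ.2 hlt
  have hk := kq_koebe hr₁0 (hφ.mono hball) (hbij.injOn.mono hball)
  rw [hs₂] at hk
  by_cases hb₂ : BddAbove {ρ : ℝ | 0 < ρ ∧ Metric.ball s₂ ρ ⊆ S₂}
  · rw [hr₂]
    refine le_csSup hb₂ ⟨by positivity, hk.trans ?_⟩
    exact (Set.image_mono hball).trans hbij.image_eq.subset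
  · exfalso
    have hS₂u := kq_not_bdd hb₂
    subst hS₂u
    have hpre : IsPreconnected S₁ := isPreconnected_iff_preconnectedSpace.2 inferInstance
    obtain ⟨ψ, hψd, hψS, hψ⟩ := kq_inverse hS₁ hpre hφ hbij
    have hinjψ : Function.Injective ψ := fun x y h => by rw [← hψ x, ← hψ y, h]
    have hψs : ψ s₂ = s₁ := hbij.injOn (hψS _) hs₁ (by rw [hψ, hs₂])
    have hψ' : deriv ψ s₂ ≠ 0 := by
      intro h0
      have e1 : HasDerivAt φ (deriv φ s₁) (ψ s₂) := by
        rw [hψs]; exact (hφ.differentiableAt (hS₁.mem_nhds hs₁)).hasDerivAt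
      have e2 := e1.comp s₂ (hψd s₂).hasDerivAt
      have e3 : φ ∘ ψ = id := funext hψ
      rw [e3, h0, mul_zero] at e2
      exact zero_ne_one (e2.unique (hasDerivAt_id s₂))
    obtain ⟨B, hB⟩ := hb₁
    have hn : 0 < ‖deriv ψ s₂‖ := norm_pos_iff.2 hψ'
    have hεB : ε ≤ B := hB ⟨hε, hεS⟩
    have hB0 : 0 < B + 1 := by linarith
    have hRpos : 0 < 4 * (B + 1) / ‖deriv ψ s₂‖ := by positivity
    have hk2 := kq_koebe hRpos (hψd.differentiableOn) (hinjψ.injOn) (c := s₂)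
    rw [hψs, show 1 / 4 * (4 * (B + 1) / ‖deriv ψ s₂‖) * ‖deriv ψ s₂‖ = B + 1 by field_simp] at hk2
    have : B + 1 ≤ B := hB ⟨hB0, hk2.trans (by rintro _ ⟨z, _, rfl⟩; exact hψS z)⟩
    linarith
end

section
/- Let J ⊂ ℂ be a nonempty compact set, z ∈ ℂ, and suppose there is an injective holomorphic map φ defined on a simply connected open set S₀ containing z with w = φ(z), such that: φ(S₀) ⊇ B(w, 32s) where s = d(w, J), a = |φ'(z)| > 0, the preimage under φ of J ∩ φ(S₀) is contained in J, and φ maps points of J ∩ S₀ into J. If additionally B(z, 8s/a) ⊆ S₀ and the Koebe 1/4 theorem applies to φ and its inverse on the relevant disks, then s/(4a) ≤ d(z, J) ≤ 8s/a. -/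
open Set Metric Filter Topology in
/-- The inverse of an injective holomorphic map is holomorphic. -/
lemma aux_inv {f : ℂ → ℂ} {U : Set ℂ} (hU : IsOpen U) (hf : DifferentiableOn ℂ f U)
    (hinj : InjOn f U) : ∃ ψ : ℂ → ℂ, IsOpen (f '' U) ∧ DifferentiableOn ℂ ψ (f '' U) ∧
      ∀ x ∈ U, ψ (f x) = x := by
  have hinv : ∀ x ∈ U, Function.invFunOn f U (f x) = x := fun x hx => hinj.leftInvOn_invFunOn hx
  set ψ := Function.invFunOn f U with hψ
  have han : ∀ x ∈ U, AnalyticAt ℂ f x := fun x hx => hf.analyticAt (hU.mem_nhds hx)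
  have hnc : ∀ x ∈ U, ¬ ∀ᶠ y in 𝓝 x, f y = f x := by
    intro x hx h
    have h2 : ∀ᶠ y in 𝓝 x, y = x := by
      filter_upwards [h, hU.mem_nhds hx] with y hy hyU using hinj hyU hx hy
    have h3 : ∀ᶠ y in 𝓝[≠] x, False := by
      rw [eventually_nhdsWithin_iff]
      filter_upwards [h2] with y hy hy2 using hy2 hy
    exact (NormedField.nhdsNE_neBot x).ne (by simpa using h3)
  have hop : ∀ x ∈ U, 𝓝 (f x) ≤ map f (𝓝 x) := fun x hx =>
    ((han x hx).eventually_constant_or_nhds_le_map_nhds).resolve_left (hnc x hx)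
  have hopen : IsOpen (f '' U) := by
    rw [isOpen_iff_mem_nhds]
    rintro _ ⟨x, hx, rfl⟩
    exact hop x hx (image_mem_map (hU.mem_nhds hx))
  have hcont : ∀ x ∈ U, ContinuousAt ψ (f x) := by
    intro x hx
    rw [ContinuousAt, hinv x hx]
    intro N hN
    have : f '' (N ∩ U) ∈ 𝓝 (f x) := hop x hx (image_mem_map (inter_mem hN (hU.mem_nhds hx)))
    rw [mem_map]
    filter_upwards [this]
    rintro _ ⟨y, hy, rfl⟩
    change ψ (f y) ∈ N
    rw [hinv y hy.2]; exact hy.1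
  have hdiff1 : ∀ x ∈ U, deriv f x ≠ 0 → DifferentiableAt ℂ ψ (f x) := by
    intro x hx h
    have : HasDerivAt f (deriv f x) (ψ (f x)) := by
      rw [hinv x hx]; exact (han x hx).differentiableAt.hasDerivAt
    refine (HasDerivAt.of_local_left_inverse (hcont x hx) this h ?_).differentiableAt
    filter_upwards [hopen.mem_nhds (mem_image_of_mem f hx)]
    rintro _ ⟨y, hy, rfl⟩
    rw [hinv y hy]
  refine ⟨ψ, hopen, ?_, hinv⟩
  rintro _ ⟨x, hx, rfl⟩
  refine DifferentiableAt.differentiableWithinAt ?_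
  refine (Complex.analyticAt_of_differentiable_on_punctured_nhds_of_continuousAt ?_
    (hcont x hx)).differentiableAt
  have hd : ∀ᶠ y in 𝓝[≠] x, deriv f y ≠ 0 := by
    refine ((han x hx).deriv.eventually_eq_zero_or_eventually_ne_zero).resolve_left ?_
    intro h
    apply hnc x hx
    obtain ⟨r, hr, hb⟩ := Metric.eventually_nhds_iff_ball.1 (h.and (hU.mem_nhds hx))
    filter_upwards [ball_mem_nhds x hr] with y hy
    have hdo : DifferentiableOn ℂ f (ball x r) := hf.mono fun u hu => (hb u hu).2
    exact (isOpen_ball.is_const_of_deriv_eq_zero (convex_ball x r).isPreconnected hdo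
      (fun u hu => (hb u hu).1) hy (mem_ball_self hr))
  rw [eventually_nhdsWithin_iff] at hd ⊢
  have hc := hcont x hx
  rw [ContinuousAt, hinv x hx] at hc
  filter_upwards [hc.eventually hd, hopen.mem_nhds (mem_image_of_mem f hx)]
  rintro _ hy ⟨y, hyU, rfl⟩ hne
  rw [hinv y hyU] at hy
  refine hdiff1 y hyU (hy ?_)
  rintro rfl
  exact hne rfl

open Set Metric Filter Topology in
lemma aux_sqrt_diff {g F : ℂ → ℂ} {x : ℂ} (hg : ContinuousAt g x) (hF : DifferentiableAt ℂ F x)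
    (h : ∀ y, g y ^ 2 = F y) (hx : g x ≠ 0) : DifferentiableAt ℂ g x := by
  have hs : HasStrictDerivAt (fun y : ℂ => y ^ 2) (2 * g x) (g x) := by
    simpa using hasStrictDerivAt_pow 2 (g x)
  have h2 : (2 * g x) ≠ 0 := by simpa using hx
  have hl := hs.to_localInverse h2
  set i := hs.localInverse (fun y : ℂ => y ^ 2) (2 * g x) (g x) h2
  have hi : DifferentiableAt ℂ i (F x) := by
    rw [← h x]; exact hl.hasDerivAt.differentiableAt
  have hli : ∀ᶠ y in 𝓝 (g x), i (y ^ 2) = y :=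
    HasStrictFDerivAt.eventually_left_inverse _
  refine (hi.comp x hF).congr_of_eventuallyEq ?_
  filter_upwards [hg.eventually hli] with y hy
  rw [Function.comp, ← h y, hy]

open Set Metric Filter Topology in
/-- The omitted value of smallest modulus. -/
lemma aux_omit {f : ℂ → ℂ} (hf : DifferentiableOn ℂ f (ball 0 1)) (hinj : InjOn f (ball 0 1))
    (h0 : f 0 = 0) (h1 : deriv f 0 = 1) :
    ∃ v : ℂ, v ≠ 0 ∧ ‖v‖ ≤ 1 ∧ (∀ x ∈ ball (0:ℂ) 1, f x ≠ v) ∧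
      IsPreconnected (ball (0:ℂ) 1 ∩ f ⁻¹' ball 0 ‖v‖) := by
  obtain ⟨ψ, hop, hψ, hinv⟩ := aux_inv isOpen_ball hf hinj
  have h0m : (0:ℂ) ∈ ball (0:ℂ) 1 := by simp
  have hψ0 : ψ 0 = 0 := by simpa [h0] using hinv 0 h0m
  have h0i : (0:ℂ) ∈ f '' ball 0 1 := ⟨0, h0m, h0⟩
  have key : ∀ d : ℝ, 0 < d → ball (0:ℂ) d ⊆ f '' ball 0 1 → d ≤ 1 := by
    intro d hd hsub
    have hle : ‖deriv ψ 0‖ ≤ 1 / d := by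
      refine Complex.norm_deriv_le_div_of_mapsTo_ball (hψ.mono hsub) ?_ hd
      intro y hy
      obtain ⟨x, hx, rfl⟩ := hsub hy
      rw [hinv x hx, hψ0]; exact ball_subset_closedBall hx
    have hf' : HasDerivAt f 1 0 := by
      rw [← h1]; exact (hf.differentiableAt (isOpen_ball.mem_nhds h0m)).hasDerivAt
    have hψ' : HasDerivAt ψ (deriv ψ 0) (f 0) := by
      rw [h0]; exact (hψ.differentiableAt (hop.mem_nhds h0i)).hasDerivAt
    have hc := hψ'.comp (0:ℂ) hf'
    have hid : HasDerivAt (ψ ∘ f) 1 (0:ℂ) := by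
      refine (hasDerivAt_id (0:ℂ)).congr_of_eventuallyEq ?_
      filter_upwards [isOpen_ball.mem_nhds h0m] with x hx using hinv x hx
    have : deriv ψ 0 = 1 := by simpa using hc.unique hid
    rw [this, norm_one, le_div_iff₀ hd] at hle
    linarith
  have hne : ((f '' ball 0 1)ᶜ).Nonempty := by
    rw [nonempty_compl]
    intro h
    have := key 2 (by norm_num) (by rw [h]; exact subset_univ _)
    norm_num at this
  obtain ⟨v, hv, hvd⟩ := hop.isClosed_compl.exists_infDist_eq_dist hne 0
  have hv0 : v ≠ 0 := by rintro rfl; exact hv h0i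
  have hsub : ball (0:ℂ) ‖v‖ ⊆ f '' ball 0 1 := by
    intro y hy
    by_contra hcon
    have := infDist_le_dist_of_mem (x := (0:ℂ)) (show y ∈ (f '' ball 0 1)ᶜ from hcon)
    rw [hvd, dist_zero_left, dist_zero_left] at this
    rw [mem_ball_zero_iff] at hy
    linarith
  refine ⟨v, hv0, key _ (norm_pos_iff.2 hv0) hsub, fun x hx h => hv ⟨x, hx, h⟩, ?_⟩
  have : ball (0:ℂ) 1 ∩ f ⁻¹' ball 0 ‖v‖ = ψ '' ball 0 ‖v‖ := by
    ext x
    constructor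
    · rintro ⟨hx, hfx⟩
      exact ⟨f x, hfx, hinv x hx⟩
    · rintro ⟨y, hy, rfl⟩
      obtain ⟨x, hx, rfl⟩ := hsub hy
      rw [hinv x hx]; exact ⟨hx, hy⟩
  rw [this]
  exact (convex_ball _ _).isPreconnected.image _ (hψ.mono hsub).continuousOn

open Set Metric Filter Topology in
lemma aux_growth {f : ℂ → ℂ} (hf : DifferentiableOn ℂ f (ball 0 1)) (hinj : InjOn f (ball 0 1))
    (h0 : f 0 = 0) (h1 : deriv f 0 = 1) (z : ℂ) (hz : ‖z‖ ≤ 1 / 32) : ‖f z‖ < 1 / 8 := by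
  obtain ⟨v, hv0, hv1, homit, hconn⟩ := aux_omit hf hinj h0 h1
  have h0m : (0:ℂ) ∈ ball (0:ℂ) 1 := by simp
  have hvn : 0 < ‖v‖ := norm_pos_iff.2 hv0
  obtain ⟨g, hgc, hg2, hg0⟩ : ∃ g : ℂ → ℂ, ContinuousOn g (ball 0 1) ∧
      (∀ x, g x ^ 2 = 1 - f x / v) ∧ g 0 = 1 := by
    have hsc : IsSimplyConnected (ball (0:ℂ) 1) := by
      have := (convex_ball (0:ℂ) 1).contractibleSpace ⟨0, h0m⟩
      exact (inferInstance : SimplyConnectedSpace (ball (0:ℂ) 1))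
    have hc : ContinuousOn (fun x => 1 - f x / v) (ball 0 1) :=
      continuousOn_const.sub (hf.continuousOn.div_const v)
    obtain ⟨g, hg, hg2⟩ := Complex.exists_continuousOn_pow_eq hsc isOpen_ball hc
      (by
        rintro ⟨x, hx, h⟩
        apply homit x hx
        field_simp at h
        linear_combination -h) two_ne_zero
    have h00 : g 0 ^ 2 = 1 := by rw [hg2, h0]; simp
    rcases (sq_eq_sq_iff_eq_or_eq_neg.1 (h00.trans (one_pow 2).symm)) with h | h
    · exact ⟨g, hg, hg2, h⟩
    · exact ⟨fun x => - g x, hg.neg, fun x => by rw [neg_sq, hg2], by simp [h]⟩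
  have hfg : ∀ x, f x = v * (1 - g x ^ 2) := fun x => by rw [hg2]; field_simp; ring
  have hgne : ∀ x ∈ ball (0:ℂ) 1, g x ≠ 0 := by
    intro x hx h
    apply homit x hx
    rw [hfg, h]; ring
  have hgd : DifferentiableOn ℂ g (ball 0 1) := fun x hx =>
    (aux_sqrt_diff (hgc.continuousAt (isOpen_ball.mem_nhds hx))
      (((hf.differentiableAt (isOpen_ball.mem_nhds hx)).div_const v).const_sub 1) hg2
      (hgne x hx)).differentiableWithinAt
  -- positivity of the real part on the preimage of the ball
  have hre : ∀ x ∈ ball (0:ℂ) 1, ‖f x‖ < ‖v‖ → 0 < (g x).re := by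
    intro x hx hfx
    by_contra hcon
    push Not at hcon
    have hc : ContinuousOn (fun y => (g y).re) (ball (0:ℂ) 1 ∩ f ⁻¹' ball 0 ‖v‖) :=
      Complex.continuous_re.comp_continuousOn (hgc.mono inter_subset_left)
    obtain ⟨y, ⟨hy, hfy⟩, hy0⟩ := hconn.intermediate_value (a := x) (b := 0)
      ⟨hx, by simpa using hfx⟩ ⟨h0m, by simpa [h0] using hv0⟩ hc
      (show (0:ℝ) ∈ Icc _ _ from ⟨hcon, by simp [hg0]⟩)
    have hlt : ‖f y / v‖ < 1 := by
      rw [norm_div, div_lt_one hvn]; simpa using hfy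
    have h3 : f y / v = 1 - g y ^ 2 := by rw [hg2]; ring
    have h4 := (Complex.re_le_norm (f y / v)).trans_lt hlt
    rw [h3] at h4
    simp only [Complex.sub_re, Complex.one_re, sq, Complex.mul_re] at h4
    simp only at hy0
    rw [hy0] at h4
    nlinarith [sq_nonneg (g y).im]
  have hg1 : ∀ x ∈ ball (0:ℂ) 1, 1 + g x ≠ 0 := by
    intro x hx h
    have hgx : g x = -1 := by linear_combination h
    have hf0 : f x = 0 := by rw [hfg, hgx]; ring
    have := hre x hx (by simpa [hf0] using hv0)
    rw [hgx] at this
    norm_num at this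
  set k : ℂ → ℂ := fun x => (1 - g x) / (1 + g x) with hk
  have hk0 : k 0 = 0 := by simp [hk, hg0]
  have hkd : DifferentiableOn ℂ k (ball 0 1) :=
    (hgd.const_sub 1).div (hgd.const_add 1) hg1
  have hfk : ∀ x ∈ ball (0:ℂ) 1, f x * (1 + k x) ^ 2 = 4 * v * k x := by
    intro x hx
    have := hg1 x hx
    rw [hfg]
    simp only [hk]
    field_simp
    ring
  have hk6 : ∀ x ∈ ball (0:ℂ) 1, ‖k x‖ ≤ 6 := by
    intro x hx
    by_contra hcon
    push Not at hcon
    have hn1 : ‖k x‖ - 1 ≤ ‖1 + k x‖ := by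
      have := norm_sub_norm_le (k x) (-1)
      rw [norm_neg, norm_one, sub_neg_eq_add, add_comm (k x)] at this
      exact this
    have hn2 : ‖f x‖ * ‖1 + k x‖ ^ 2 = 4 * ‖v‖ * ‖k x‖ := by
      have := congrArg norm (hfk x hx)
      simpa using this
    have hlt : ‖f x‖ < ‖v‖ := by
      by_contra hge
      push Not at hge
      have : ‖v‖ * (‖k x‖ - 1) ^ 2 ≤ ‖f x‖ * ‖1 + k x‖ ^ 2 := by
        gcongr
        linarith
      rw [hn2] at this
      have : (‖k x‖ - 1) ^ 2 ≤ 4 * ‖k x‖ := by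
        refine le_of_mul_le_mul_left ?_ hvn
        linarith
      nlinarith
    have hpos := hre x hx hlt
    have : ‖k x‖ ≤ 1 := by
      simp only [hk]
      rw [norm_div, div_le_one (norm_pos_iff.2 (hg1 x hx))]
      rw [← sq_le_sq₀ (norm_nonneg _) (norm_nonneg _), ← Complex.normSq_eq_norm_sq,
        ← Complex.normSq_eq_norm_sq, Complex.normSq_apply, Complex.normSq_apply]
      simp
      nlinarith
    linarith
  have hzm : z ∈ ball (0:ℂ) 1 := by
    rw [mem_ball_zero_iff]; linarith
  set q := dslope k 0 with hq
  have hqd : DifferentiableOn ℂ q (ball 0 1) :=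
    (Complex.differentiableOn_dslope (isOpen_ball.mem_nhds h0m)).2 hkd
  have hq6 : ∀ x ∈ ball (0:ℂ) 1, ‖q x‖ ≤ 6 := by
    intro x hx
    have := Complex.norm_dslope_le_div_of_mapsTo_ball (R₂ := 6) hkd
      (fun y hy => by rw [hk0, mem_closedBall_zero_iff]; exact hk6 y hy) hx
    simpa using this
  have hkq : k z = z * q z := by
    have := sub_smul_dslope k 0 z
    simpa [hk0] using this.symm
  have hq0 : 4 * v * q 0 = 1 := by
    rw [hq, dslope_same]
    have hk' : HasDerivAt k (deriv k 0) 0 :=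
      (hkd.differentiableAt (isOpen_ball.mem_nhds h0m)).hasDerivAt
    have hf' : HasDerivAt f 1 0 := by
      rw [← h1]; exact (hf.differentiableAt (isOpen_ball.mem_nhds h0m)).hasDerivAt
    have hL := hf'.mul ((hk'.const_add 1).pow 2)
    have hR := hk'.const_mul (4 * v)
    have hR2 := hR.congr_of_eventuallyEq (f₁ := fun x => f x * (1 + k x) ^ 2) (by
      filter_upwards [isOpen_ball.mem_nhds h0m] with x hx using hfk x hx)
    have := hR2.unique hL
    rw [this]
    simp [h0, hk0]
  have hqz : ‖q z - q 0‖ ≤ 12 * ‖z‖ := by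
    have := Complex.dist_le_div_mul_dist_of_mapsTo_ball (R₂ := 12) hqd
      (fun y hy => by
        rw [mem_closedBall, dist_eq_norm]
        linarith [norm_sub_le (q y) (q 0), hq6 y hy, hq6 0 h0m]) hzm
    simpa [dist_eq_norm] using this
  have hqn : ‖q z‖ ≤ ‖q 0‖ + 12 / 32 := by
    have := norm_add_le (q z - q 0) (q 0)
    rw [sub_add_cancel] at this
    linarith
  have hq0n : 4 * ‖v‖ * ‖q 0‖ = 1 := by
    have := congrArg norm hq0
    simpa using this
  have hkz : ‖k z‖ ≤ 6 / 32 := by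
    rw [hkq, norm_mul]
    have := hq6 z hzm
    nlinarith [norm_nonneg z, norm_nonneg (q z)]
  have hlow : 26 / 32 ≤ ‖1 + k z‖ := by
    have := norm_sub_norm_le 1 (-k z)
    rw [norm_neg, norm_one, sub_neg_eq_add] at this
    linarith
  have heq : ‖f z‖ * ‖1 + k z‖ ^ 2 = 4 * ‖v‖ * (‖z‖ * ‖q z‖) := by
    have := congrArg norm (hfk z hzm)
    rw [hkq] at this ⊢
    simpa using this
  have hA : ‖f z‖ * (26 / 32) ^ 2 ≤ ‖f z‖ * ‖1 + k z‖ ^ 2 := by gcongr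
  have hB : 4 * ‖v‖ * (‖z‖ * ‖q z‖) ≤ 4 * ‖v‖ * (1 / 32 * (‖q 0‖ + 12 / 32)) := by gcongr
  nlinarith

open Set Metric Filter Topology in
lemma aux_growth' {F : ℂ → ℂ} {c x : ℂ} {R : ℝ} (hR : 0 < R) (hF : DifferentiableOn ℂ F (ball c R))
    (hinj : InjOn F (ball c R)) (h1 : deriv F c ≠ 0) (hx : ‖x - c‖ ≤ R / 32) :
    ‖F x - F c‖ < ‖deriv F c‖ * R / 8 := by
  have hRc : (R : ℂ) ≠ 0 := by exact_mod_cast hR.ne'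
  have hm : ∀ u ∈ ball (0:ℂ) 1, c + R * u ∈ ball c R := by
    intro u hu
    rw [mem_ball_zero_iff] at hu
    rw [mem_ball, dist_eq_norm, add_sub_cancel_left, norm_mul, Complex.norm_real,
      Real.norm_of_nonneg hR.le]
    nlinarith
  set f : ℂ → ℂ := fun u => (F (c + R * u) - F c) / (R * deriv F c) with hf
  have hfd : DifferentiableOn ℂ f (ball 0 1) := by
    have : DifferentiableOn ℂ (fun u : ℂ => F (c + R * u)) (ball 0 1) :=
      hF.comp (g := F) (f := fun u : ℂ => c + R * u) (by fun_prop) hm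
    exact (this.sub_const _).div_const _
  have hfi : InjOn f (ball 0 1) := by
    intro u hu u' hu' h
    simp only [hf] at h
    have h2 : F (c + R * u) = F (c + R * u') := by
      rw [div_left_inj' (mul_ne_zero hRc h1)] at h
      linear_combination h
    have := hinj (hm u hu) (hm u' hu') h2
    exact mul_left_cancel₀ hRc (add_left_cancel this)
  have hf1 : deriv f 0 = 1 := by
    have hc : HasDerivAt F (deriv F c) (c + R * 0) := by
      rw [mul_zero, add_zero]
      exact (hF.differentiableAt (ball_mem_nhds c hR)).hasDerivAt
    have hl : HasDerivAt (fun u : ℂ => c + R * u) (R * 1) 0 :=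
      ((hasDerivAt_id (0:ℂ)).const_mul (R:ℂ)).const_add c
    have := ((hc.comp (0:ℂ) hl).sub_const (F c)).div_const (R * deriv F c)
    have h3 := this.deriv
    refine Eq.trans h3 ?_
    field_simp
  have := aux_growth hfd hfi (by simp [hf]) hf1 ((x - c) / R) (by
    rw [norm_div, Complex.norm_real, Real.norm_of_nonneg hR.le, div_le_iff₀ hR]; linarith)
  simp only [hf] at this
  rw [mul_div_cancel₀ _ hRc, add_sub_cancel, norm_div, norm_mul, Complex.norm_real,
    Real.norm_of_nonneg hR.le, div_lt_iff₀ (mul_pos hR (norm_pos_iff.2 h1))] at this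
  linarith


/-- Koebe distortion estimate for distances to a compact set:
under the hypotheses below — `φ` injective and holomorphic on a simply connected
open set `S₀ ∋ z`, `w = φ(z)`, `s = d(w, J)`, `a = |φ'(z)| > 0`, the image of
`S₀` contains `B(w, 32s)`, `φ` respects `J` in both directions, and
`B(z, 8s/a) ⊆ S₀` — one gets `s/(4a) ≤ d(z, J) ≤ 8s/a`. -/
theorem stmt17 (J : Set ℂ) (hJne : J.Nonempty) (hJc : IsCompact J)
    (S₀ : Set ℂ) (hS₀ : IsOpen S₀) (hsc : SimplyConnectedSpace S₀)
    (z : ℂ) (hz : z ∈ S₀)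
    (φ : ℂ → ℂ) (hφ : DifferentiableOn ℂ φ S₀) (hinj : Set.InjOn φ S₀)
    (w : ℂ) (hw : w = φ z)
    (s : ℝ) (hs : s = Metric.infDist w J)
    (a : ℝ) (ha : a = ‖deriv φ z‖) (ha0 : 0 < a)
    (himg : Metric.ball w (32 * s) ⊆ φ '' S₀)
    (hpre : ∀ x ∈ S₀, φ x ∈ J → x ∈ J)
    (hfwd : ∀ x ∈ J ∩ S₀, φ x ∈ J)
    (hball : Metric.ball z (8 * s / a) ⊆ S₀) :
    s / (4 * a) ≤ Metric.infDist z J ∧ Metric.infDist z J ≤ 8 * s / a := by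
  have hs0 : 0 ≤ s := hs ▸ Metric.infDist_nonneg
  have hd0 : deriv φ z ≠ 0 := by
    rw [← norm_pos_iff, ← ha]; exact ha0
  rcases hs0.eq_or_lt with h0 | hpos
  · have hwJ : w ∈ J := by
      rw [hJc.isClosed.mem_iff_infDist_zero hJne, ← hs, ← h0]
    have hzJ : z ∈ J := hpre z hz (hw ▸ hwJ)
    rw [Metric.infDist_zero_of_mem hzJ, ← h0]
    simp
  constructor
  · rw [Metric.le_infDist hJne]
    intro x hx
    by_contra hcon
    push Not at hcon
    have hR : 0 < 8 * s / a := by positivity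
    have hle : ‖x - z‖ ≤ 8 * s / a / 32 := by
      rw [← dist_eq_norm, dist_comm]
      refine hcon.le.trans (le_of_eq ?_)
      field_simp; norm_num
    have hlt := aux_growth' hR (hφ.mono hball) (hinj.mono hball) hd0 hle
    rw [← ha] at hlt
    have hxS : x ∈ S₀ := by
      apply hball
      rw [Metric.mem_ball, dist_eq_norm]
      linarith
    have hge := Metric.infDist_le_dist_of_mem (x := w) (hfwd x ⟨hx, hxS⟩)
    rw [← hs, dist_comm, dist_eq_norm, hw] at hge
    have : a * (8 * s / a) / 8 = s := by field_simp
    linarith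
  · obtain ⟨ψ, hop, hψ, hinv⟩ := aux_inv hS₀ hφ hinj
    obtain ⟨p, hpJ, hp⟩ := hJc.exists_infDist_eq_dist hJne w
    have hψz : ψ w = z := by rw [hw]; exact hinv z hz
    have hψ' : deriv ψ w * deriv φ z = 1 := by
      have h1 : HasDerivAt φ (deriv φ z) z :=
        (hφ.differentiableAt (hS₀.mem_nhds hz)).hasDerivAt
      have h2 : HasDerivAt ψ (deriv ψ w) (φ z) := by
        rw [hw]
        exact (hψ.differentiableAt (hop.mem_nhds (Set.mem_image_of_mem φ hz))).hasDerivAt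
      refine (h2.comp z h1).unique ((hasDerivAt_id z).congr_of_eventuallyEq ?_)
      filter_upwards [hS₀.mem_nhds hz] with x hx using hinv x hx
    have hψ0 : deriv ψ w ≠ 0 := left_ne_zero_of_mul_eq_one hψ'
    have hψn : ‖deriv ψ w‖ = 1 / a := by
      have := congrArg norm hψ'
      rw [norm_mul, ← ha, norm_one] at this
      rw [eq_div_iff ha0.ne']; exact this
    have hψi : Set.InjOn ψ (Metric.ball w (32 * s)) := by
      intro y hy y' hy' h
      obtain ⟨x, hx, rfl⟩ := himg hy
      obtain ⟨x', hx', rfl⟩ := himg hy'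
      rw [hinv x hx, hinv x' hx'] at h
      rw [h]
    have hps : ‖p - w‖ = s := by rw [← dist_eq_norm, dist_comm, ← hp, hs]
    have hlt := aux_growth' (x := p) (by positivity : 0 < 32 * s) (hψ.mono himg) hψi hψ0
      (by rw [hps]; linarith)
    rw [hψn, hψz] at hlt
    obtain ⟨x, hx, hxp⟩ := himg (show p ∈ Metric.ball w (32 * s) by
      rw [Metric.mem_ball, dist_eq_norm, hps]; linarith)
    have hψp : ψ p = x := by rw [← hxp]; exact hinv x hx
    have hxJ : x ∈ J := hpre x hx (hxp ▸ hpJ)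
    have hle := Metric.infDist_le_dist_of_mem (x := z) hxJ
    rw [dist_comm, dist_eq_norm, ← hψp] at hle
    have h4 : 1 / a * (32 * s) / 8 = 4 * s / a := by ring
    have h5 : 4 * s / a ≤ 8 * s / a := by gcongr; norm_num
    linarith
end
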